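/- arXiv:1705.03969 — 2 statements merged into one kernel-verified Lean document; each statement's English description precedes it below -/
import Mathlib

section
/- Let 0 < α < 1, λ ≥ 0, and let f : [0,b] × ℝ → ℝ be continuous and globally Lipschitz in its second argument. If y₁ and y₂ are continuous solutions on [0,b] of the tempered Volterra integral equation y_j(t) = y_j(0) e^{-λt} + (1/Γ(α)) ∫₀ᵗ e^{-λ(t-s)} (t-s)^{α-1} f(s, y_j(s)) ds with distinct initial values y₁(0) ≠ y₂(0), then y₁(t) ≠ y₂(t) for every t ∈ [0,b]. -/
open Real Set

open MeasureTheory Filter Topology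

theorem integral_rpow_mul_sub_rpow {α h σ : ℝ} (hα : 0 < α) (hh : 0 < h) (hσ : h < σ) :
    ∫ τ in h..σ, τ ^ (-α - 1) * (σ - τ) ^ (α - 1) = h ^ (-α) * (σ - h) ^ α / (α * σ) := by
  have hσ0 : 0 < σ := hh.trans hσ
  have hcont : ContinuousOn (fun τ : ℝ => -(τ ^ (-α) * (σ - τ) ^ α / (α * σ))) (Icc h σ) := by
    refine ((ContinuousOn.mul ?_ ?_).div_const _).neg
    · exact continuousOn_id.rpow_const fun x hx => Or.inl (hh.trans_le hx.1).ne'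
    · exact (continuousOn_const.sub continuousOn_id).rpow_const fun x _ => Or.inr hα.le
  have hderiv : ∀ τ ∈ Ioo h σ, HasDerivAt (fun τ : ℝ => -(τ ^ (-α) * (σ - τ) ^ α / (α * σ)))
      (τ ^ (-α - 1) * (σ - τ) ^ (α - 1)) τ := by
    intro τ hτ
    have hτ0 : 0 < τ := hh.trans hτ.1
    have hστ : 0 < σ - τ := sub_pos.2 hτ.2
    have h₁ : HasDerivAt (fun τ : ℝ => τ ^ (-α)) (-α * τ ^ (-α - 1)) τ :=
      Real.hasDerivAt_rpow_const (Or.inl hτ0.ne')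
    have h₂ : HasDerivAt (fun τ : ℝ => (σ - τ) ^ α) (-1 * α * (σ - τ) ^ (α - 1)) τ :=
      ((hasDerivAt_id τ).const_sub σ).rpow_const (Or.inl hστ.ne')
    convert! ((h₁.mul h₂).div_const (α * σ)).neg using 1
    have e₁ : τ ^ (-α) = τ ^ (-α - 1) * τ := by
      rw [← Real.rpow_add_one hτ0.ne']; ring_nf
    have e₂ : (σ - τ) ^ α = (σ - τ) ^ (α - 1) * (σ - τ) := by
      rw [← Real.rpow_add_one hστ.ne']; ring_nf
    rw [e₁, e₂]
    field_simp
    ring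
  have hint : IntervalIntegrable (fun τ : ℝ => τ ^ (-α - 1) * (σ - τ) ^ (α - 1)) volume h σ := by
    rw [intervalIntegrable_iff_integrableOn_Ioc_of_le hσ.le]
    refine intervalIntegral.integrableOn_deriv_of_nonneg hcont hderiv fun τ hτ => ?_
    exact mul_nonneg (rpow_nonneg (hh.trans hτ.1).le _) (rpow_nonneg (sub_pos.2 hτ.2).le _)
  rw [intervalIntegral.integral_eq_sub_of_hasDerivAt_of_le hσ.le hcont hderiv hint]
  simp [Real.zero_rpow hα.ne']

theorem integral_rpow_mul_integral_sub_rpow {α h T : ℝ} (hα : 0 < α) (hh : 0 < h) (hT : h ≤ T)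
    {ψ : ℝ → ℝ} (hψ : Continuous ψ) :
    ∫ τ in h..T, τ ^ (-α - 1) * ∫ σ in τ..T, (σ - τ) ^ (α - 1) * ψ σ =
      ∫ σ in h..T, h ^ (-α) * (σ - h) ^ α / (α * σ) * ψ σ := by
  set a : ℝ → ℝ := (Ioc h T).indicator fun τ => τ ^ (-α - 1)
  set g : ℝ → ℝ := (Ioc 0 T).indicator fun x => x ^ (α - 1)
  set q : ℝ → ℝ := (Icc 0 T).indicator ψ
  have ha : Integrable a := by
    refine IntegrableOn.integrable_indicator ?_ measurableSet_Ioc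
    refine (ContinuousOn.integrableOn_Icc ?_).mono_set Ioc_subset_Icc_self
    exact continuousOn_id.rpow_const fun x hx => Or.inl (hh.trans_le hx.1).ne'
  have hg : Integrable g := by
    refine IntegrableOn.integrable_indicator ?_ measurableSet_Ioc
    exact (intervalIntegral.intervalIntegrable_rpow' (by linarith)).1
  have hq : AEStronglyMeasurable (fun p : ℝ × ℝ => q p.1) (volume.prod volume) :=
    ((hψ.measurable.indicator measurableSet_Icc).comp measurable_fst).aestronglyMeasurable
  obtain ⟨M, hM⟩ := isCompact_Icc.exists_bound_of_continuousOn (hψ.continuousOn (s := Icc 0 T))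
  have hK : Integrable (fun p : ℝ × ℝ => a p.2 * g (p.1 - p.2) * q p.1)
      (volume.prod volume) := by
    refine (ha.convolution_integrand (ContinuousLinearMap.mul ℝ ℝ) hg).mul_bdd (c := |M|) hq ?_
    refine Eventually.of_forall fun p => ?_
    by_cases hp : p.1 ∈ Icc 0 T
    · simpa [q, hp] using (hM _ hp).trans (le_abs_self M)
    · simp [q, hp]
  have hswap := integral_integral_swap (f := fun σ τ => a τ * g (σ - τ) * q σ) hK
  rw [intervalIntegral.integral_of_le hT, intervalIntegral.integral_of_le hT,
    ← integral_indicator measurableSet_Ioc, ← integral_indicator measurableSet_Ioc]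
  convert! hswap.symm using 2
  · ext τ
    by_cases hτ : τ ∈ Ioc h T
    · have hτ0 : 0 < τ := hh.trans hτ.1
      simp only [a, hτ, indicator_of_mem, mul_assoc, integral_const_mul]
      congr 1
      rw [intervalIntegral.integral_of_le hτ.2, ← integral_indicator measurableSet_Ioc]
      congr 1
      ext σ
      by_cases hσ : σ ∈ Ioc τ T
      · have h₁ : σ - τ ∈ Ioc 0 T := ⟨sub_pos.2 hσ.1, by linarith [hσ.2]⟩
        have h₂ : σ ∈ Icc 0 T := ⟨by linarith [hσ.1], hσ.2⟩
        simp [g, q, hσ, h₁, h₂]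
      · rw [indicator_of_notMem hσ]
        by_cases h₂ : σ ∈ Icc 0 T
        · have h₁ : σ - τ ∉ Ioc 0 T := fun h' => hσ ⟨sub_pos.1 h'.1, h₂.2⟩
          simp [g, h₁]
        · simp [q, h₂]
    · simp [a, hτ]
  · ext σ
    by_cases hσ : σ ∈ Ioc h T
    · have h₂ : σ ∈ Icc 0 T := ⟨by linarith [hσ.1], hσ.2⟩
      rw [indicator_of_mem hσ, integral_mul_const, ← integral_rpow_mul_sub_rpow hα hh hσ.1,
        intervalIntegral.integral_of_le hσ.1.le, integral_Ioc_eq_integral_Ioo,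
        ← integral_indicator measurableSet_Ioo]
      simp only [q, h₂, indicator_of_mem]
      congr 2
      ext τ
      by_cases hτ : τ ∈ Ioo h σ
      · have h₁ : σ - τ ∈ Ioc 0 T := ⟨sub_pos.2 hτ.2, by linarith [hτ.1, hσ.2]⟩
        have h₃ : τ ∈ Ioc h T := ⟨hτ.1, hτ.2.le.trans hσ.2⟩
        simp [a, g, hτ, h₁, h₃]
      · rw [indicator_of_notMem hτ]
        by_cases h₃ : τ ∈ Ioc h T
        · have h₁ : σ - τ ∉ Ioc 0 T := fun h' => hτ ⟨h₃.1, sub_pos.1 h'.1⟩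
          simp [g, h₁]
        · simp [a, h₃]
    · rw [indicator_of_notMem hσ]
      by_cases h₂ : σ ∈ Icc 0 T
      · refine (integral_eq_zero_of_ae (Eventually.of_forall fun τ => ?_)).symm
        by_cases h₃ : τ ∈ Ioc h T
        · have h₁ : σ - τ ∉ Ioc 0 T := fun h' => hσ ⟨h₃.1.trans (sub_pos.1 h'.1), h₂.2⟩
          simp [g, h₁]
        · simp [a, h₃]
      · simp [q, h₂]

theorem sub_rpow_div_le {α h σ : ℝ} (hα1 : α ≤ 1) (hh : 0 < h) (hσ : h ≤ σ) :
    σ ^ (α - 1) - (σ - h) ^ α / σ ≤ h * σ ^ (α - 2) := by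
  have hσ0 : 0 < σ := hh.trans_le hσ
  have hx := Real.self_le_rpow_of_le_one (x := (σ - h) / σ) (div_nonneg (sub_nonneg.2 hσ) hσ0.le)
    ((div_le_one hσ0).2 (by linarith)) hα1
  rw [Real.div_rpow (sub_nonneg.2 hσ) hσ0.le, le_div_iff₀ (rpow_pos_of_pos hσ0 _)] at hx
  rw [Real.rpow_sub_one hσ0.ne', Real.rpow_sub hσ0, Real.rpow_two]
  calc σ ^ α / σ - (σ - h) ^ α / σ ≤ σ ^ α / σ - (σ - h) / σ * σ ^ α / σ := by gcongr
    _ = h * (σ ^ α / σ ^ 2) := by field_simp; ring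

theorem sub_rpow_div_nonneg {α h σ : ℝ} (hα : 0 ≤ α) (hh : 0 < h) (hσ : h ≤ σ) :
    0 ≤ σ ^ (α - 1) - (σ - h) ^ α / σ := by
  have hσ0 : 0 < σ := hh.trans_le hσ
  rw [Real.rpow_sub_one hσ0.ne', sub_nonneg]
  gcongr
  · linarith

/-- The contribution of `ψ` to a truncated Marchaud derivative is small when `ψ` is. -/
theorem integral_sub_integral_le {α h T ε C : ℝ} (hα0 : 0 < α) (hα1 : α < 1) (hh : 0 < h)
    (hT : h ≤ T) (hε : 0 ≤ ε) (hC : 0 ≤ C) {ψ : ℝ → ℝ} (hψ : Continuous ψ)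
    (hbound : ∀ σ ∈ Icc 0 T, ψ σ ≤ ε + C * σ) :
    (∫ σ in (0 : ℝ)..T, σ ^ (α - 1) * ψ σ) - ∫ σ in h..T, (σ - h) ^ α / σ * ψ σ ≤
      h ^ α * (ε * (1 / α + 1 / (1 - α)) + C * h / α + C * h ^ (1 - α) * T ^ α / α) := by
  have hT0 : 0 < T := hh.trans_le hT
  have hi (a b : ℝ) : IntervalIntegrable (fun σ : ℝ => σ ^ (α - 1)) volume a b :=
    intervalIntegral.intervalIntegrable_rpow' (by linarith)
  have hiψ (a b : ℝ) : IntervalIntegrable (fun σ : ℝ => σ ^ (α - 1) * ψ σ) volume a b :=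
    (hi a b).mul_continuousOn hψ.continuousOn
  have hne : (0 : ℝ) ∉ uIcc h T := by
    rw [uIcc_of_le hT]; exact fun h' => hh.not_ge h'.1
  have hi₂ : IntervalIntegrable (fun σ : ℝ => σ ^ (α - 2)) volume h T :=
    intervalIntegral.intervalIntegrable_rpow (Or.inr hne)
  have hi₃ : IntervalIntegrable (fun σ : ℝ => (σ - h) ^ α / σ * ψ σ) volume h T := by
    refine ContinuousOn.intervalIntegrable (ContinuousOn.mul (ContinuousOn.div ?_ continuousOn_id ?_)
      hψ.continuousOn)
    · exact (continuousOn_id.sub continuousOn_const).rpow_const fun _ _ => Or.inr hα0.le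
    · exact fun x hx h' => hne (by simpa [← h'] using hx)
  have near : ∫ σ in (0 : ℝ)..h, σ ^ (α - 1) * ψ σ ≤ h ^ α / α * (ε + C * h) := by
    calc ∫ σ in (0 : ℝ)..h, σ ^ (α - 1) * ψ σ
        ≤ ∫ σ in (0 : ℝ)..h, σ ^ (α - 1) * (ε + C * h) := by
          refine intervalIntegral.integral_mono_on hh.le (hiψ _ _) ((hi _ _).mul_const _) ?_
          intro σ hσ
          refine mul_le_mul_of_nonneg_left ?_ (rpow_nonneg hσ.1 _)
          have := mul_le_mul_of_nonneg_left hσ.2 hC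
          linarith [hbound σ ⟨hσ.1, hσ.2.trans hT⟩]
      _ = h ^ α / α * (ε + C * h) := by
          rw [intervalIntegral.integral_mul_const, integral_rpow (Or.inl (by linarith))]
          simp [hα0.ne']
  have far : ∫ σ in h..T, (σ ^ (α - 1) * ψ σ - (σ - h) ^ α / σ * ψ σ) ≤
      h * ε * ((h ^ (α - 1) - T ^ (α - 1)) / (1 - α)) + h * C * ((T ^ α - h ^ α) / α) := by
    calc ∫ σ in h..T, (σ ^ (α - 1) * ψ σ - (σ - h) ^ α / σ * ψ σ)
        ≤ ∫ σ in h..T, (h * ε * σ ^ (α - 2) + h * C * σ ^ (α - 1)) := by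
          refine intervalIntegral.integral_mono_on hT ((hiψ _ _).sub hi₃)
            ((hi₂.const_mul _).add ((hi _ _).const_mul _)) ?_
          intro σ hσ
          have hσ0 : 0 < σ := hh.trans_le hσ.1
          have hpow : σ ^ (α - 1) = σ ^ (α - 2) * σ := by
            rw [← Real.rpow_add_one hσ0.ne']; ring_nf
          calc σ ^ (α - 1) * ψ σ - (σ - h) ^ α / σ * ψ σ
              = (σ ^ (α - 1) - (σ - h) ^ α / σ) * ψ σ := by ring
            _ ≤ (σ ^ (α - 1) - (σ - h) ^ α / σ) * (ε + C * σ) :=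
                mul_le_mul_of_nonneg_left (hbound σ ⟨hσ0.le, hσ.2⟩)
                  (sub_rpow_div_nonneg hα0.le hh hσ.1)
            _ ≤ h * σ ^ (α - 2) * (ε + C * σ) :=
                mul_le_mul_of_nonneg_right (sub_rpow_div_le hα1.le hh hσ.1) (by positivity)
            _ = h * ε * σ ^ (α - 2) + h * C * σ ^ (α - 1) := by rw [hpow]; ring
      _ = _ := by
          rw [intervalIntegral.integral_add (hi₂.const_mul _) ((hi _ _).const_mul _),
            intervalIntegral.integral_const_mul, intervalIntegral.integral_const_mul,
            integral_rpow (Or.inr ⟨by linarith, hne⟩), integral_rpow (Or.inl (by linarith)),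
            show α - 2 + 1 = -(1 - α) by ring, div_neg, ← neg_div, neg_sub]
          simp
  rw [intervalIntegral.integral_sub (hiψ _ _) hi₃] at far
  rw [← intervalIntegral.integral_add_adjacent_intervals (hiψ 0 h) (hiψ h T)]
  have e₁ : h * h ^ (α - 1) = h ^ α := by
    rw [mul_comm, ← Real.rpow_add_one hh.ne']; ring_nf
  have e₂ : h ^ α * h ^ (1 - α) = h := by
    rw [← Real.rpow_add hh]; simp
  have h1α : 0 < 1 - α := by linarith
  have b₁ : h * ε * ((h ^ (α - 1) - T ^ (α - 1)) / (1 - α)) ≤ h ^ α * ε / (1 - α) := by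
    rw [← e₁, ← mul_div_assoc]
    have : 0 ≤ h * ε * T ^ (α - 1) := by positivity
    refine div_le_div_of_nonneg_right ?_ h1α.le
    linear_combination this
  have b₂ : h * C * ((T ^ α - h ^ α) / α) ≤ h ^ α * (C * h ^ (1 - α) * T ^ α / α) := by
    have e₃ : h ^ α * (C * h ^ (1 - α) * T ^ α / α) = h * C * (T ^ α / α) := by
      linear_combination (C * T ^ α / α) * e₂
    rw [e₃]
    gcongr
    linarith [rpow_nonneg hh.le α]
  calc _ ≤ h ^ α / α * (ε + C * h) +
        (h ^ α * ε / (1 - α) + h ^ α * (C * h ^ (1 - α) * T ^ α / α)) := by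
          linarith
    _ = _ := by ring

/-- Truncated extremum principle for a fractional integral equation in reversed time: the initial
value `c`, taken at `T`, of a nonnegative solution `u` that vanishes at the final time `0` is
controlled by the forcing term `ψ`. -/
theorem initial_value_mul_rpow_le {α h T c : ℝ} (hα0 : 0 < α) (hh : 0 < h)
    (hT : h ≤ T) {u ψ : ℝ → ℝ} (hu : ContinuousOn u (Icc 0 T)) (hψ : Continuous ψ)
    (hnonneg : ∀ τ ∈ Icc 0 T, 0 ≤ u τ) (hu0 : u 0 = 0)
    (heq : ∀ τ ∈ Icc 0 T, u τ = c - ∫ σ in τ..T, (σ - τ) ^ (α - 1) * ψ σ) :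
    h ^ α * (c * T ^ (-α)) ≤
      (∫ σ in (0 : ℝ)..T, σ ^ (α - 1) * ψ σ) - ∫ σ in h..T, (σ - h) ^ α / σ * ψ σ := by
  have hT0 : 0 < T := hh.trans_le hT
  have hc : ∫ σ in (0 : ℝ)..T, σ ^ (α - 1) * ψ σ = c := by
    have := heq 0 ⟨le_rfl, hT0.le⟩
    simp only [sub_zero, hu0] at this
    linarith
  have hne : (0 : ℝ) ∉ uIcc h T := by
    rw [uIcc_of_le hT]; exact fun h' => hh.not_ge h'.1
  have hsub : Icc h T ⊆ Icc 0 T := Icc_subset_Icc_left hh.le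
  have hp : ContinuousOn (fun τ : ℝ => τ ^ (-α - 1)) (uIcc h T) :=
    continuousOn_id.rpow_const fun x hx => Or.inl fun h' => hne (by simpa [← h'] using hx)
  have hswap := integral_rpow_mul_integral_sub_rpow hα0 hh hT hψ
  have hle : ∫ τ in h..T, τ ^ (-α - 1) * ∫ σ in τ..T, (σ - τ) ^ (α - 1) * ψ σ ≤
      ∫ τ in h..T, τ ^ (-α - 1) * c := by
    calc _ = ∫ τ in h..T, τ ^ (-α - 1) * (c - u τ) := by
          refine intervalIntegral.integral_congr fun τ hτ => ?_
          rw [uIcc_of_le hT] at hτ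
          simp [heq τ (hsub hτ)]
      _ ≤ _ := by
          refine intervalIntegral.integral_mono_on hT ?_ ?_ fun τ hτ => ?_
          · refine (hp.mul (continuousOn_const.sub (hu.mono ?_))).intervalIntegrable
            rwa [uIcc_of_le hT]
          · exact (hp.mul continuousOn_const).intervalIntegrable
          · exact mul_le_mul_of_nonneg_left (by linarith [hnonneg τ (hsub hτ)])
              (rpow_nonneg (hsub hτ).1 _)
  rw [hswap, intervalIntegral.integral_mul_const,
    integral_rpow (Or.inr ⟨by linarith, hne⟩)] at hle
  have hfactor : ∫ σ in h..T, h ^ (-α) * (σ - h) ^ α / (α * σ) * ψ σ =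
      h ^ (-α) / α * ∫ σ in h..T, (σ - h) ^ α / σ * ψ σ := by
    rw [← intervalIntegral.integral_const_mul]
    congr 1
    ext σ
    ring
  rw [hfactor, sub_add_cancel] at hle
  have hmul := mul_le_mul_of_nonneg_left hle (mul_pos hα0 (rpow_pos_of_pos hh α)).le
  have e : h ^ α * h ^ (-α) = 1 := by rw [← Real.rpow_add hh]; simp
  have l : α * h ^ α * (h ^ (-α) / α * ∫ σ in h..T, (σ - h) ^ α / σ * ψ σ) =
      ∫ σ in h..T, (σ - h) ^ α / σ * ψ σ := by
    generalize ∫ σ in h..T, (σ - h) ^ α / σ * ψ σ = I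
    field_simp
    linear_combination I * e
  have r : α * h ^ α * ((T ^ (-α) - h ^ (-α)) / -α * c) = c - h ^ α * (c * T ^ (-α)) := by
    field_simp
    linear_combination c * e
  rw [l, r] at hmul
  linarith

/-- A nonnegative solution of a fractional integral equation (in reversed time) whose value and
forcing term both vanish at the final time has nonpositive initial value. -/
theorem initial_value_nonpos {α T c : ℝ} (hα0 : 0 < α) (hα1 : α < 1) (hT : 0 < T)
    {u ψ : ℝ → ℝ} (hu : ContinuousOn u (Icc 0 T)) (hψ : Continuous ψ) (hψ0 : ψ 0 = 0)
    (hnonneg : ∀ τ ∈ Icc 0 T, 0 ≤ u τ) (hu0 : u 0 = 0)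
    (heq : ∀ τ ∈ Icc 0 T, u τ = c - ∫ σ in τ..T, (σ - τ) ^ (α - 1) * ψ σ) : c ≤ 0 := by
  by_contra! hc
  set K := 1 / α + 1 / (1 - α)
  have h1α : 0 < 1 - α := by linarith
  have hK : 0 < K := by positivity
  have hcT : 0 < c * T ^ (-α) := by positivity
  set ε := c * T ^ (-α) / (2 * K) with hεdef
  have hε : 0 < ε := by positivity
  obtain ⟨δ, hδ, hδε⟩ := Metric.continuous_iff.1 hψ 0 ε hε
  obtain ⟨M, hM⟩ := isCompact_Icc.exists_bound_of_continuousOn (hψ.continuousOn (s := Icc 0 T))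
  have hbound : ∀ σ ∈ Icc 0 T, ψ σ ≤ ε + |M| / δ * σ := by
    intro σ hσ
    by_cases hσδ : σ < δ
    · have h₁ := hδε σ (by simpa [abs_of_nonneg hσ.1] using hσδ)
      rw [hψ0, Real.dist_eq, sub_zero] at h₁
      have : 0 ≤ |M| / δ * σ := mul_nonneg (by positivity) hσ.1
      linarith [le_abs_self (ψ σ)]
    · have h₁ : |M| ≤ |M| / δ * σ := by
        rw [div_mul_eq_mul_div, le_div_iff₀ hδ]
        exact mul_le_mul_of_nonneg_left (not_lt.1 hσδ) (abs_nonneg M)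
      have h₂ := hM σ hσ
      rw [Real.norm_eq_abs] at h₂
      linarith [le_abs_self (ψ σ), le_abs_self M]
  set C := |M| / δ
  have hlim : Tendsto (fun h : ℝ => ε * K + C * h / α + C * h ^ (1 - α) * T ^ α / α) (𝓝[>] 0)
      (𝓝 (ε * K)) := by
    have hcont : Continuous fun h : ℝ => ε * K + C * h / α + C * h ^ (1 - α) * T ^ α / α := by
      have := Real.continuous_rpow_const (q := 1 - α) h1α.le
      fun_prop
    simpa [Real.zero_rpow h1α.ne'] using (hcont.tendsto 0).mono_left nhdsWithin_le_nhds
  have hle : c * T ^ (-α) ≤ ε * K := by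
    refine ge_of_tendsto hlim ?_
    filter_upwards [Ioc_mem_nhdsGT hT] with h hh
    refine le_of_mul_le_mul_left ?_ (rpow_pos_of_pos hh.1 α)
    exact (initial_value_mul_rpow_le hα0 hh.1 hh.2 hu hψ hnonneg hu0 heq).trans
      (integral_sub_integral_le hα0 hα1 hh.1 hh.2 hε.le (by positivity) hψ hbound)
  have : ε * K = c * T ^ (-α) / 2 := by
    rw [hεdef]; field_simp
  linarith

theorem tempered_volterra_sub {α lam b : ℝ} (hα0 : 0 < α) {p q y₁ y₂ : ℝ → ℝ}
    (hp : Continuous p) (hq : Continuous q)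
    (heq₁ : ∀ t ∈ Icc (0 : ℝ) b, y₁ t = y₁ 0 * Real.exp (-lam * t) +
      (1 / Real.Gamma α) * ∫ s in (0 : ℝ)..t, Real.exp (-lam * (t - s)) * (t - s) ^ (α - 1) * p s)
    (heq₂ : ∀ t ∈ Icc (0 : ℝ) b, y₂ t = y₂ 0 * Real.exp (-lam * t) +
      (1 / Real.Gamma α) * ∫ s in (0 : ℝ)..t, Real.exp (-lam * (t - s)) * (t - s) ^ (α - 1) * q s)
    {t : ℝ} (ht : t ∈ Icc 0 b) :
    Real.exp (lam * t) * (y₁ t - y₂ t) = (y₁ 0 - y₂ 0) +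
      ∫ s in (0 : ℝ)..t, (t - s) ^ (α - 1) * (Real.exp (lam * s) * (p s - q s) / Real.Gamma α) := by
  have hk : IntervalIntegrable (fun s : ℝ => (t - s) ^ (α - 1)) volume 0 t := by
    simpa using! (intervalIntegral.intervalIntegrable_rpow' (a := t) (b := 0)
      (by linarith : -1 < α - 1)).comp_sub_left t
  have hi {r : ℝ → ℝ} (hr : Continuous r) : IntervalIntegrable
      (fun s : ℝ => Real.exp (-lam * (t - s)) * (t - s) ^ (α - 1) * r s) volume 0 t :=
    (hk.continuousOn_mul (by fun_prop)).mul_continuousOn hr.continuousOn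
  have hsub : (∫ s in (0 : ℝ)..t,
        (t - s) ^ (α - 1) * (Real.exp (lam * s) * (p s - q s) / Real.Gamma α)) =
      Real.exp (lam * t) * (1 / Real.Gamma α) *
        ((∫ s in (0 : ℝ)..t, Real.exp (-lam * (t - s)) * (t - s) ^ (α - 1) * p s) -
          ∫ s in (0 : ℝ)..t, Real.exp (-lam * (t - s)) * (t - s) ^ (α - 1) * q s) := by
    rw [← intervalIntegral.integral_sub (hi hp) (hi hq), ← intervalIntegral.integral_const_mul]
    congr 1
    ext s
    have e : Real.exp (lam * s) = Real.exp (lam * t) * Real.exp (-lam * (t - s)) := by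
      rw [← Real.exp_add]; ring_nf
    rw [e]
    ring
  have e : Real.exp (lam * t) * Real.exp (-lam * t) = 1 := by
    rw [← Real.exp_add]; simp
  rw [hsub, heq₁ t ht, heq₂ t ht]
  linear_combination (y₁ 0 - y₂ 0) * e

theorem tempered_trajectories_ne_of_lt {α lam b : ℝ} (hα0 : 0 < α) (hα1 : α < 1) (hb : 0 < b)
    {f : ℝ → ℝ → ℝ} (hf : Continuous fun p : ℝ × ℝ => f p.1 p.2)
    {y₁ y₂ : ℝ → ℝ} (hy₁ : ContinuousOn y₁ (Icc 0 b)) (hy₂ : ContinuousOn y₂ (Icc 0 b))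
    (heq₁ : ∀ t ∈ Icc (0 : ℝ) b, y₁ t = y₁ 0 * Real.exp (-lam * t) + (1 / Real.Gamma α) *
      ∫ s in (0 : ℝ)..t, Real.exp (-lam * (t - s)) * (t - s) ^ (α - 1) * f s (y₁ s))
    (heq₂ : ∀ t ∈ Icc (0 : ℝ) b, y₂ t = y₂ 0 * Real.exp (-lam * t) + (1 / Real.Gamma α) *
      ∫ s in (0 : ℝ)..t, Real.exp (-lam * (t - s)) * (t - s) ^ (α - 1) * f s (y₂ s))
    (h0 : y₂ 0 < y₁ 0) {t : ℝ} (ht : t ∈ Icc 0 b) : y₁ t ≠ y₂ t := by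
  intro hmeet
  -- continuous extensions of the trajectories to the whole line
  obtain ⟨z₁, hz₁, hz₁y⟩ : ∃ z : ℝ → ℝ, Continuous z ∧ ∀ s ∈ Icc 0 b, z s = y₁ s :=
    ⟨_, hy₁.domRestrict.Icc_extend', fun s hs => IccExtend_of_mem hb.le _ hs⟩
  obtain ⟨z₂, hz₂, hz₂y⟩ : ∃ z : ℝ → ℝ, Continuous z ∧ ∀ s ∈ Icc 0 b, z s = y₂ s :=
    ⟨_, hy₂.domRestrict.Icc_extend', fun s hs => IccExtend_of_mem hb.le _ hs⟩
  have hp : Continuous fun s => f s (z₁ s) := hf.comp (continuous_id.prodMk hz₁)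
  have hq : Continuous fun s => f s (z₂ s) := hf.comp (continuous_id.prodMk hz₂)
  have congr_ext {z y : ℝ → ℝ} (hzy : ∀ s ∈ Icc 0 b, z s = y s) {t : ℝ} (ht : t ∈ Icc 0 b) :
      ∫ s in (0 : ℝ)..t, Real.exp (-lam * (t - s)) * (t - s) ^ (α - 1) * f s (y s) =
        ∫ s in (0 : ℝ)..t, Real.exp (-lam * (t - s)) * (t - s) ^ (α - 1) * f s (z s) := by
    refine intervalIntegral.integral_congr fun s hs => ?_
    rw [uIcc_of_le ht.1] at hs
    simp only [hzy s ⟨hs.1, hs.2.trans ht.2⟩]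
  set w : ℝ → ℝ := fun t => Real.exp (lam * t) * (y₁ t - y₂ t) with hw
  set g : ℝ → ℝ := fun s => Real.exp (lam * s) * (f s (z₁ s) - f s (z₂ s)) / Real.Gamma α with hg
  have hwg : ∀ t ∈ Icc 0 b, w t = (y₁ 0 - y₂ 0) + ∫ s in (0 : ℝ)..t, (t - s) ^ (α - 1) * g s :=
    fun t ht => tempered_volterra_sub hα0 hp hq
      (fun t ht => by rw [← congr_ext hz₁y ht]; exact heq₁ t ht)
      (fun t ht => by rw [← congr_ext hz₂y ht]; exact heq₂ t ht) ht
  have hwc : ContinuousOn w (Icc 0 b) := by fun_prop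
  have hgc : Continuous g := by fun_prop
  have hw0 : 0 < w 0 := by simpa [hw] using h0
  -- the first time at which the weighted difference vanishes
  obtain ⟨T, hT, hleast⟩ : ∃ T, IsLeast (Icc 0 b ∩ w ⁻¹' Iic 0) T :=
    ((isCompact_Icc.of_isClosed_subset
      (hwc.preimage_isClosed_of_isClosed isClosed_Icc isClosed_Iic) inter_subset_left)).exists_isLeast
      ⟨t, ht, by simp [hw, hmeet]⟩
  have hT0 : 0 < T := hT.1.1.lt_of_ne fun h => hw0.not_ge (by simpa [← h] using hT.2)
  have hsub : Icc 0 T ⊆ Icc 0 b := Icc_subset_Icc_right hT.1.2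
  have hwT : w T = 0 := by
    obtain ⟨s, hs, hws⟩ := intermediate_value_Icc' hT0.le (hwc.mono hsub) ⟨hT.2, hw0.le⟩
    have : s = T := hs.2.antisymm (hleast ⟨hsub hs, hws.le⟩)
    rwa [this] at hws
  have hpos : ∀ s ∈ Icc 0 T, 0 ≤ w s := by
    intro s hs
    rcases hs.2.eq_or_lt with rfl | hlt
    · exact hwT.ge
    · by_contra! hneg
      exact hlt.not_ge (hleast ⟨hsub hs, hneg.le⟩)
  have hgT : g T = 0 := by
    have : y₁ T = y₂ T := by simpa [hw, sub_eq_zero] using hwT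
    simp [hg, hz₁y T hT.1, hz₂y T hT.1, this]
  have hmaps : MapsTo (fun τ => T - τ) (Icc 0 T) (Icc 0 T) :=
    fun τ hτ => ⟨sub_nonneg.2 hτ.2, sub_le_self _ hτ.1⟩
  have hc : y₁ 0 - y₂ 0 ≤ 0 := by
    refine initial_value_nonpos (u := fun τ => w (T - τ)) (ψ := fun σ => -g (T - σ)) hα0 hα1 hT0
      ((hwc.mono hsub).comp (by fun_prop) hmaps) (by fun_prop) (by simp [hgT])
      (fun τ hτ => hpos _ (hmaps hτ)) (by simpa using hwT) fun τ hτ => ?_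
    have hrev := intervalIntegral.integral_comp_sub_left
      (fun s => (T - τ - s) ^ (α - 1) * g s) T (a := τ) (b := T)
    rw [sub_self] at hrev
    rw [hwg _ (hsub (hmaps hτ)), ← hrev]
    simp
  linarith

/-- trajectories of the tempered Volterra equation with distinct initial
values never intersect. -/
theorem tempered_trajectories_never_intersect
    (α lam b L : ℝ) (hα0 : 0 < α) (hα1 : α < 1) (hlam : 0 ≤ lam) (hb : 0 < b)
    (f : ℝ → ℝ → ℝ) (hf : Continuous fun p : ℝ × ℝ => f p.1 p.2)
    (hL : ∀ t ∈ Set.Icc (0 : ℝ) b, ∀ u v : ℝ, |f t u - f t v| ≤ L * |u - v|)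
    (y₁ y₂ : ℝ → ℝ)
    (hy₁ : ContinuousOn y₁ (Set.Icc 0 b)) (hy₂ : ContinuousOn y₂ (Set.Icc 0 b))
    (heq₁ : ∀ t ∈ Set.Icc (0 : ℝ) b,
      y₁ t = y₁ 0 * Real.exp (-lam * t) +
        (1 / Real.Gamma α) *
          ∫ s in (0 : ℝ)..t, Real.exp (-lam * (t - s)) * (t - s) ^ (α - 1) * f s (y₁ s))
    (heq₂ : ∀ t ∈ Set.Icc (0 : ℝ) b,
      y₂ t = y₂ 0 * Real.exp (-lam * t) +
        (1 / Real.Gamma α) *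
          ∫ s in (0 : ℝ)..t, Real.exp (-lam * (t - s)) * (t - s) ^ (α - 1) * f s (y₂ s))
    (h0 : y₁ 0 ≠ y₂ 0) :
    ∀ t ∈ Set.Icc (0 : ℝ) b, y₁ t ≠ y₂ t := by
  intro t ht
  rcases h0.lt_or_gt with h | h
  · exact (tempered_trajectories_ne_of_lt hα0 hα1 hb hf hy₂ hy₁ heq₂ heq₁ h ht).symm
  · exact tempered_trajectories_ne_of_lt hα0 hα1 hb hf hy₁ hy₂ heq₁ heq₂ h ht
end

section
/- Let 0 < α < 1, λ ≥ 0, b > 0, and let f : [0,b] × ℝ → ℝ be continuous and globally Lipschitz in its second argument. Then for every c ∈ ℝ there exists exactly one c₀ ∈ ℝ such that the unique continuous solution y of y(t) = c₀ e^{-λt} + (1/Γ(α)) ∫₀ᵗ e^{-λ(t-s)} (t-s)^{α-1} f(s, y(s)) ds satisfies y(b) = c e^{-λb}. -/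
open Real Set

/-- The (unnormalised) Abel integral `∫₀ᵗ (t - s) ^ (α - 1) h(s) ds`. -/
noncomputable def abelIntegral (α : ℝ) (h : ℝ → ℝ) (t : ℝ) : ℝ :=
  ∫ s in (0 : ℝ)..t, (t - s) ^ (α - 1) * h s

theorem intervalIntegrable_sub_rpow {α : ℝ} (hα : 0 < α) (T a c : ℝ) :
    IntervalIntegrable (fun s => (T - s) ^ (α - 1)) MeasureTheory.volume a c := by
  have h := (intervalIntegral.intervalIntegrable_rpow' (a := T - a) (b := T - c)
    (r := α - 1) (by linarith)).comp_sub_left T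
  simpa using h

theorem intervalIntegrable_sub_rpow_mul {α : ℝ} (hα : 0 < α) {h : ℝ → ℝ} (hh : Continuous h)
    (T a c : ℝ) :
    IntervalIntegrable (fun s => (T - s) ^ (α - 1) * h s) MeasureTheory.volume a c :=
  (intervalIntegrable_sub_rpow hα T a c).mul_continuousOn hh.continuousOn

@[simp] theorem abelIntegral_zero_right (α : ℝ) (h : ℝ → ℝ) : abelIntegral α h 0 = 0 := by
  simp [abelIntegral]

theorem abelIntegral_eq_reflect (α : ℝ) (h : ℝ → ℝ) (t : ℝ) :
    abelIntegral α h t = ∫ r in (0 : ℝ)..t, r ^ (α - 1) * h (t - r) := by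
  have := intervalIntegral.integral_comp_sub_left (a := 0) (b := t)
    (fun r => r ^ (α - 1) * h (t - r)) t
  simpa [abelIntegral] using this

theorem abelIntegral_congr {α : ℝ} {h₁ h₂ : ℝ → ℝ} {t : ℝ} (ht : 0 ≤ t)
    (h : ∀ s ∈ Icc 0 t, h₁ s = h₂ s) : abelIntegral α h₁ t = abelIntegral α h₂ t := by
  refine intervalIntegral.integral_congr fun s hs => ?_
  rw [uIcc_of_le ht] at hs
  simp only [h s hs]

theorem abelIntegral_sub {α : ℝ} (hα : 0 < α) {h₁ h₂ : ℝ → ℝ} (c₁ : Continuous h₁)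
    (c₂ : Continuous h₂) (t : ℝ) :
    abelIntegral α (fun s => h₁ s - h₂ s) t = abelIntegral α h₁ t - abelIntegral α h₂ t := by
  simp only [abelIntegral, mul_sub]
  exact intervalIntegral.integral_sub (intervalIntegrable_sub_rpow_mul hα c₁ _ _ _)
    (intervalIntegrable_sub_rpow_mul hα c₂ _ _ _)

theorem abelIntegral_const_mul (α c : ℝ) (h : ℝ → ℝ) (t : ℝ) :
    abelIntegral α (fun s => c * h s) t = c * abelIntegral α h t := by
  simp only [abelIntegral, ← intervalIntegral.integral_const_mul]
  congr 1; ext s; ring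

theorem continuous_abelIntegral {α : ℝ} (hα : 0 < α) {h : ℝ → ℝ} (hh : Continuous h) :
    Continuous (abelIntegral α h) := by
  have e : abelIntegral α h = fun t => ∫ r in (0 : ℝ)..t, r ^ (α - 1) * h (t - r) :=
    funext (abelIntegral_eq_reflect α h)
  rw [e, continuous_iff_continuousAt]
  intro t₀
  set R := |t₀| + 1 with hR
  have hRpos : 0 < R := by positivity
  obtain ⟨C, hC⟩ := (isCompact_Icc (a := -(2 * R)) (b := 2 * R)).exists_bound_of_continuousOn
    hh.continuousOn
  have ht₀ : t₀ ∈ Ioo (-R) R := by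
    constructor <;> linarith [neg_abs_le t₀, le_abs_self t₀]
  have hm : Measurable fun r : ℝ => r ^ (α - 1) := by fun_prop
  have key := intervalIntegral.continuousAt_parametric_primitive_of_dominated
    (μ := MeasureTheory.volume) (F := fun t r : ℝ => r ^ (α - 1) * h (t - r)) (x₀ := t₀)
    (a₀ := 0) (b₀ := t₀) (fun r => ‖r ^ (α - 1)‖ * C) (-R) R
    (fun x => (hm.mul (by fun_prop : Measurable fun r => h (x - r))).aestronglyMeasurable)
    (by
      filter_upwards [Ioo_mem_nhds ht₀.1 ht₀.2] with x hx
      refine (MeasureTheory.ae_restrict_iff' measurableSet_uIoc).2 (.of_forall fun r hr => ?_)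
      rw [uIoc_of_le (by linarith)] at hr
      rw [norm_mul]
      refine mul_le_mul_of_nonneg_left (hC _ ⟨?_, ?_⟩) (norm_nonneg _)
      · linarith [hx.1, hr.2]
      · linarith [hx.2, hr.1])
    ((intervalIntegral.intervalIntegrable_rpow' (by linarith)).norm.mul_const C)
    (.of_forall fun r => by fun_prop)
    ⟨by linarith, hRpos⟩ ht₀ (by simp)
  exact key.comp (f := fun t : ℝ => (t, t)) (by fun_prop)

/-- Associativity of convolution, for the Abel kernel and two continuous functions. -/
theorem integral_mul_abelIntegral {α : ℝ} (hα : 0 < α) {E h : ℝ → ℝ} (hE : Continuous E)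
    (hh : Continuous h) {t : ℝ} (ht : 0 ≤ t) :
    ∫ s in (0 : ℝ)..t, E (t - s) * abelIntegral α h s =
      ∫ r in (0 : ℝ)..t, abelIntegral α E (t - r) * h r := by
  set kI : ℝ → ℝ := (Ioc 0 t).indicator fun x => x ^ (α - 1) with hkI
  set hI : ℝ → ℝ := (Ioc 0 t).indicator h with hhI
  set EI : ℝ → ℝ := (Icc 0 t).indicator E with hEI
  have ikI : MeasureTheory.Integrable kI := by
    rw [hkI, MeasureTheory.integrable_indicator_iff measurableSet_Ioc]
    exact (intervalIntegrable_iff_integrableOn_Ioc_of_le ht).1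
      (intervalIntegral.intervalIntegrable_rpow' (by linarith))
  have ihI : MeasureTheory.Integrable hI := by
    rw [hhI, MeasureTheory.integrable_indicator_iff measurableSet_Ioc]
    exact (intervalIntegrable_iff_integrableOn_Ioc_of_le ht).1 (hh.intervalIntegrable _ _)
  obtain ⟨C, hC⟩ := (isCompact_Icc (a := 0) (b := t)).exists_bound_of_continuousOn
    hE.continuousOn
  have bEI : ∀ x, ‖EI x‖ ≤ C := by
    intro x
    by_cases hx : x ∈ Icc 0 t
    · simpa [hEI, hx] using hC x hx
    · simpa [hEI, hx] using (norm_nonneg _).trans (hC 0 ⟨le_rfl, ht⟩)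
  have mEI : Measurable EI := hE.measurable.indicator measurableSet_Icc
  have hint : MeasureTheory.Integrable
      (Function.uncurry fun s r : ℝ => EI (t - s) * (hI r * kI (s - r)))
      (MeasureTheory.volume.prod MeasureTheory.volume) := by
    refine MeasureTheory.Integrable.bdd_mul (c := C)
      (g := fun p : ℝ × ℝ => hI p.2 * kI (p.1 - p.2))
      (f := fun p : ℝ × ℝ => EI (t - p.1)) ?_ ?_ ?_
    · exact ihI.convolution_integrand (ContinuousLinearMap.mul ℝ ℝ) ikI
    · exact (mEI.comp (by fun_prop)).aestronglyMeasurable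
    · exact .of_forall fun p => bEI _
  have swap := MeasureTheory.integral_integral_swap hint
  have left : ∀ s, ∫ r, EI (t - s) * (hI r * kI (s - r)) =
      (Ioc 0 t).indicator (fun s => E (t - s) * abelIntegral α h s) s := by
    intro s
    rw [MeasureTheory.integral_const_mul]
    by_cases hs : s ∈ Ioc 0 t
    · have h1 : EI (t - s) = E (t - s) := by
        rw [hEI, indicator_of_mem]; constructor <;> linarith [hs.1, hs.2]
      have h2 : (fun r => hI r * kI (s - r)) =
          (Ioo 0 s).indicator fun r => (s - r) ^ (α - 1) * h r := by
        ext r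
        by_cases hr : r ∈ Ioo 0 s
        · have a1 : r ∈ Ioc 0 t := ⟨hr.1, by linarith [hr.2, hs.2]⟩
          have a2 : s - r ∈ Ioc 0 t := ⟨by linarith [hr.2], by linarith [hr.1, hs.2]⟩
          simp only [hhI, hkI, indicator_of_mem a1, indicator_of_mem a2, indicator_of_mem hr]
          ring
        · rw [indicator_of_notMem hr]
          by_cases a1 : r ∈ Ioc 0 t
          · have a2 : s - r ∉ Ioc 0 t := fun a2 => hr ⟨a1.1, by linarith [a2.1]⟩
            simp [hkI, indicator_of_notMem a2]
          · simp [hhI, indicator_of_notMem a1]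
      rw [indicator_of_mem hs, h1, h2, MeasureTheory.integral_indicator measurableSet_Ioo,
        ← MeasureTheory.integral_Ioc_eq_integral_Ioo, abelIntegral,
        intervalIntegral.integral_of_le hs.1.le]
    · rw [indicator_of_notMem hs]
      by_cases h0 : s = 0
      · have : ∀ r, hI r * kI (s - r) = 0 := by
          intro r
          by_cases a1 : r ∈ Ioc 0 t
          · have a2 : s - r ∉ Ioc 0 t := fun a2 => by linarith [a2.1, a1.1]
            simp [hkI, indicator_of_notMem a2]
          · simp [hhI, indicator_of_notMem a1]
        simp [this]
      · have : t - s ∉ Icc 0 t := fun a => hs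
          ⟨lt_of_le_of_ne (by linarith [a.2]) (Ne.symm h0), by linarith [a.1]⟩
        simp [hEI, indicator_of_notMem this]
  have right : ∀ r, ∫ s, EI (t - s) * (hI r * kI (s - r)) =
      (Ioc 0 t).indicator (fun r => abelIntegral α E (t - r) * h r) r := by
    intro r
    have e : ∀ s, EI (t - s) * (hI r * kI (s - r)) = hI r * (EI (t - s) * kI (s - r)) :=
      fun s => by ring
    simp only [e]
    rw [MeasureTheory.integral_const_mul]
    by_cases hr : r ∈ Ioc 0 t
    · have h1 : hI r = h r := by rw [hhI, indicator_of_mem hr]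
      have h2 : (fun s => EI (t - s) * kI (s - r)) =
          (Ioc r t).indicator fun s => (s - r) ^ (α - 1) * E (t - s) := by
        ext s
        by_cases hs : s ∈ Ioc r t
        · have a1 : t - s ∈ Icc 0 t := ⟨by linarith [hs.2], by linarith [hs.1, hr.1]⟩
          have a2 : s - r ∈ Ioc 0 t := ⟨by linarith [hs.1], by linarith [hr.1, hs.2]⟩
          simp only [hEI, hkI, indicator_of_mem a1, indicator_of_mem a2, indicator_of_mem hs]
          ring
        · rw [indicator_of_notMem hs]
          by_cases a1 : t - s ∈ Icc 0 t
          · have a2 : s - r ∉ Ioc 0 t :=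
              fun a2 => hs ⟨by linarith [a2.1], by linarith [a1.1]⟩
            simp [hkI, indicator_of_notMem a2]
          · simp [hEI, indicator_of_notMem a1]
      have h3 := intervalIntegral.integral_comp_sub_left (a := r) (b := t)
        (fun x => (t - r - x) ^ (α - 1) * E x) t
      have h4 : ∀ s : ℝ, t - r - (t - s) = s - r := fun s => by ring
      simp only [h4, sub_self] at h3
      rw [indicator_of_mem hr, h1, h2, MeasureTheory.integral_indicator measurableSet_Ioc,
        ← intervalIntegral.integral_of_le hr.2, h3, mul_comm, abelIntegral]
    · rw [indicator_of_notMem hr, hhI, indicator_of_notMem hr, zero_mul]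
  simp only [left, right] at swap
  rw [MeasureTheory.integral_indicator measurableSet_Ioc,
    MeasureTheory.integral_indicator measurableSet_Ioc] at swap
  rwa [intervalIntegral.integral_of_le ht, intervalIntegral.integral_of_le ht]

theorem abelIntegral_exp_le {α ν t : ℝ} (hα : 0 < α) (hν : 0 < ν) (ht : 0 ≤ t) :
    abelIntegral α (fun s => exp (ν * s)) t ≤ (1 / ν) ^ α * Gamma α * exp (ν * t) := by
  have hI := Real.integral_rpow_mul_exp_neg_mul_Ioi hα hν
  have hint : MeasureTheory.IntegrableOn (fun r : ℝ => r ^ (α - 1) * exp (-(ν * r))) (Ioi 0) := by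
    refine MeasureTheory.Integrable.of_integral_ne_zero ?_
    rw [hI]
    have := Gamma_pos_of_pos hα
    positivity
  have e : abelIntegral α (fun s => exp (ν * s)) t =
      (∫ r in (0 : ℝ)..t, r ^ (α - 1) * exp (-(ν * r))) * exp (ν * t) := by
    rw [abelIntegral_eq_reflect, ← intervalIntegral.integral_mul_const]
    congr 1; ext r
    rw [mul_assoc, ← Real.exp_add]
    congr 2; ring
  rw [e, ← hI, intervalIntegral.integral_of_le ht]
  refine mul_le_mul_of_nonneg_right ?_ (exp_pos _).le
  refine MeasureTheory.setIntegral_mono_set hint ?_ Ioc_subset_Ioi_self.eventuallyLE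
  refine (MeasureTheory.ae_restrict_iff' measurableSet_Ioi).2 (.of_forall fun r hr => ?_)
  have : (0 : ℝ) < r := hr
  simp only [Pi.zero_apply]
  positivity

theorem abs_abelIntegral_sub_le {α ν C t : ℝ} (hα : 0 < α) (hν : 0 < ν) (hC : 0 ≤ C)
    (ht : 0 ≤ t) {h₁ h₂ : ℝ → ℝ} (c₁ : Continuous h₁) (c₂ : Continuous h₂)
    (hle : ∀ s ∈ Icc 0 t, |h₁ s - h₂ s| ≤ C * exp (ν * s)) :
    |abelIntegral α h₁ t - abelIntegral α h₂ t| ≤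
      C * ((1 / ν) ^ α * Gamma α) * exp (ν * t) := by
  rw [← abelIntegral_sub hα c₁ c₂]
  have h1 : |abelIntegral α (fun s => h₁ s - h₂ s) t| ≤
      abelIntegral α (fun s => C * exp (ν * s)) t := by
    rw [← Real.norm_eq_abs]
    refine intervalIntegral.norm_integral_le_of_norm_le ht (.of_forall fun s hs => ?_)
      (intervalIntegrable_sub_rpow_mul hα (by fun_prop) _ _ _)
    have hk : 0 ≤ (t - s) ^ (α - 1) := rpow_nonneg (by linarith [hs.2]) _
    rw [norm_mul, Real.norm_eq_abs, abs_of_nonneg hk]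
    exact mul_le_mul_of_nonneg_left (hle s ⟨hs.1.le, hs.2⟩) hk
  rw [abelIntegral_const_mul] at h1
  calc _ ≤ _ := h1
    _ ≤ C * ((1 / ν) ^ α * Gamma α * exp (ν * t)) :=
      mul_le_mul_of_nonneg_left (abelIntegral_exp_le hα hν ht) hC
    _ = _ := by ring

/-- A continuous solution of `D = p - K ∫₀ᵗ (t - s) ^ (α - 1) D(s) ds` with `D 0 > 0` stays positive
if the forcing term `p` divided by the kernel is nondecreasing. -/
theorem pos_of_eq_sub_abelIntegral {α K B : ℝ} (hα0 : 0 < α) (hα1 : α < 1) (hK : 0 ≤ K)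
    {D p : ℝ → ℝ} (hD : Continuous D) (hD0 : 0 < D 0)
    (heq : ∀ t ∈ Icc 0 B, D t = p t - K * abelIntegral α D t)
    (hp : ∀ t t', 0 < t → t ≤ t' → t' ≤ B → p t * t' ^ (α - 1) ≤ p t' * t ^ (α - 1)) :
    ∀ t ∈ Icc 0 B, 0 < D t := by
  by_contra! hneg
  have hcpt : IsCompact {t ∈ Icc 0 B | D t ≤ 0} :=
    isCompact_Icc.inter_right (isClosed_le hD continuous_const)
  obtain ⟨T, ⟨⟨hT0, hTB⟩, hDT⟩, hmin⟩ := hcpt.exists_isLeast hneg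
  have hTpos : 0 < T := lt_of_le_of_ne hT0 fun h => by rw [← h] at hDT; linarith
  have hpos : ∀ s, 0 ≤ s → s < T → 0 < D s := by
    intro s hs0 hsT
    by_contra! hs
    exact absurd (hmin ⟨⟨hs0, by linarith⟩, hs⟩) (by linarith)
  have hev : ∀ᶠ τ in nhds T, K * ((T - τ) ^ α / α) < T ^ (α - 1) / τ ^ (α - 1) := by
    have hc1 : ContinuousAt (fun τ : ℝ => K * ((T - τ) ^ α / α)) T := by
      have : Continuous fun τ : ℝ => (T - τ) ^ α :=
        (by fun_prop : Continuous fun τ : ℝ => T - τ).rpow_const fun _ => Or.inr hα0.le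
      exact (by fun_prop : Continuous fun τ : ℝ => K * ((T - τ) ^ α / α)).continuousAt
    have hTk : T ^ (α - 1) ≠ 0 := (rpow_pos_of_pos hTpos _).ne'
    have hc2 : ContinuousAt (fun τ : ℝ => T ^ (α - 1) / τ ^ (α - 1)) T :=
      continuousAt_const.div (continuousAt_id.rpow_const (Or.inl hTpos.ne')) hTk
    refine hc1.eventually_lt hc2 ?_
    rw [sub_self, zero_rpow hα0.ne', div_self hTk]
    simp
  obtain ⟨l, ⟨hl0, hlT⟩, hl⟩ := (mem_nhdsLE_iff_exists_mem_Ico_Ioc_subset hTpos).1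
    (mem_nhdsWithin_of_mem_nhds hev)
  set t₀ := (l + T) / 2 with ht₀
  obtain ⟨t, ⟨ht0, htT⟩, hmax⟩ := isCompact_Icc.exists_isMaxOn
    (nonempty_Icc.2 (by linarith : t₀ ≤ T)) hD.continuousOn
  have hDt₀ : 0 < D t₀ := hpos _ (by linarith) (by linarith)
  have hDt : 0 < D t := hDt₀.trans_le (hmax ⟨le_rfl, by linarith⟩)
  have htT' : t < T := lt_of_le_of_ne htT fun h => by rw [h] at hDt; linarith
  have htpos : 0 < t := by linarith
  set ρ := T ^ (α - 1) / t ^ (α - 1) with hρ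
  have hkt : 0 < t ^ (α - 1) := rpow_pos_of_pos htpos _
  have hρt : K * ((T - t) ^ α / α) < ρ := hl ⟨by linarith, htT⟩
  have hpT : ρ * p t ≤ p T := by
    have := hp t T htpos htT hTB
    rw [hρ, div_mul_eq_mul_div, div_le_iff₀ hkt]
    linarith
  have h1 : ∫ s in (0 : ℝ)..t, (T - s) ^ (α - 1) * D s ≤ ρ * abelIntegral α D t := by
    rw [abelIntegral, ← intervalIntegral.integral_const_mul]
    refine intervalIntegral.integral_mono_on_of_le_Ioo htpos.le
      (intervalIntegrable_sub_rpow_mul hα0 hD _ _ _)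
      ((intervalIntegrable_sub_rpow_mul hα0 hD _ _ _).const_mul _) fun s hs => ?_
    rw [← mul_assoc]
    refine mul_le_mul_of_nonneg_right ?_ (hpos s hs.1.le (hs.2.trans htT')).le
    rw [hρ, div_mul_eq_mul_div, le_div_iff₀ hkt, ← mul_rpow (by linarith [hs.2]) htpos.le,
      ← mul_rpow hT0 (by linarith [hs.2])]
    refine rpow_le_rpow_of_nonpos (mul_pos hTpos (by linarith [hs.2])) ?_ (by linarith)
    nlinarith [hs.1]
  have h2 : ∫ s in t..T, (T - s) ^ (α - 1) * D s ≤ (T - t) ^ α / α * D t := by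
    have e : ∫ s in t..T, (T - s) ^ (α - 1) * D t = (T - t) ^ α / α * D t := by
      rw [intervalIntegral.integral_mul_const,
        intervalIntegral.integral_comp_sub_left (fun x => x ^ (α - 1)) T,
        integral_rpow (Or.inl (by linarith))]
      simp [zero_rpow hα0.ne']
    rw [← e]
    refine intervalIntegral.integral_mono_on htT (intervalIntegrable_sub_rpow_mul hα0 hD _ _ _)
      ((intervalIntegrable_sub_rpow hα0 _ _ _).mul_const _) fun s hs => ?_
    exact mul_le_mul_of_nonneg_left (hmax ⟨by linarith [hs.1], hs.2⟩)
      (rpow_nonneg (by linarith [hs.2]) _)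
  have hsplit : abelIntegral α D T =
      (∫ s in (0 : ℝ)..t, (T - s) ^ (α - 1) * D s) + ∫ s in t..T, (T - s) ^ (α - 1) * D s :=
    (intervalIntegral.integral_add_adjacent_intervals
      (intervalIntegrable_sub_rpow_mul hα0 hD _ _ _)
      (intervalIntegrable_sub_rpow_mul hα0 hD _ _ _)).symm
  have eT := heq T ⟨hT0, hTB⟩
  have et := heq t ⟨htpos.le, by linarith⟩
  have h3 : K * abelIntegral α D T ≤
      K * (ρ * abelIntegral α D t + (T - t) ^ α / α * D t) := by
    rw [hsplit]
    exact mul_le_mul_of_nonneg_left (add_le_add h1 h2) hK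
  have h4 : ρ * D t = ρ * p t - K * (ρ * abelIntegral α D t) := by rw [et]; ring
  have h5 : 0 < (ρ - K * ((T - t) ^ α / α)) * D t := mul_pos (by linarith) hDt
  nlinarith

/-- The function `E` is a fundamental solution on `[0, b]`: `E = 1 - K ∫₀ᵗ (t - s) ^ (α - 1) E(s) ds`
(a Mittag-Leffler function). -/
structure IsAbelRelaxation (α K b : ℝ) (E : ℝ → ℝ) : Prop where
  continuous : Continuous E
  eq : ∀ t ∈ Icc 0 b, E t = 1 - K * abelIntegral α E t

theorem IsAbelRelaxation.apply_zero {α K b : ℝ} {E : ℝ → ℝ} (hb : 0 ≤ b)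
    (hE : IsAbelRelaxation α K b E) : E 0 = 1 := by
  simpa using hE.eq 0 ⟨le_rfl, hb⟩

theorem IsAbelRelaxation.pos {α K b : ℝ} {E : ℝ → ℝ} (hα0 : 0 < α) (hα1 : α < 1) (hK : 0 ≤ K)
    (hb : 0 ≤ b) (hE : IsAbelRelaxation α K b E) : ∀ t ∈ Icc 0 b, 0 < E t := by
  refine pos_of_eq_sub_abelIntegral (p := fun _ => 1) hα0 hα1 hK hE.continuous
    (by rw [hE.apply_zero hb]; exact one_pos) hE.eq fun t t' ht htt' _ => ?_
  simpa using rpow_le_rpow_of_nonpos ht htt' (by linarith)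

theorem IsAbelRelaxation.antitoneOn {α K b : ℝ} {E : ℝ → ℝ} (hα0 : 0 < α) (hα1 : α < 1)
    (hK : 0 < K) (hb : 0 ≤ b) (hE : IsAbelRelaxation α K b E) : AntitoneOn E (Icc 0 b) := by
  intro x hx y hy hxy
  rcases hxy.eq_or_lt with rfl | hlt
  · rfl
  have hpos := hE.pos hα0 hα1 hK.le hb
  have hc := hE.continuous
  set δ := y - x with hδ
  have hδ0 : 0 < δ := by linarith
  have hδb : δ ≤ b := by linarith [hy.2, hx.1]
  have hcδ : Continuous fun t => E (t + δ) := by fun_prop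
  have main := pos_of_eq_sub_abelIntegral (B := b - δ) (D := fun t => E t - E (t + δ))
    (p := fun t => K * ∫ s in (0 : ℝ)..δ, (t + δ - s) ^ (α - 1) * E s) hα0 hα1 hK.le
    (by fun_prop) ?_ ?_ ?_ x ⟨hx.1, by linarith [hy.2]⟩
  · have : x + δ = y := by rw [hδ]; ring
    rw [this] at main
    linarith
  · have h1 : 0 < abelIntegral α E δ := by
      refine intervalIntegral.intervalIntegral_pos_of_pos_on
        (intervalIntegrable_sub_rpow_mul hα0 hc _ _ _) (fun s hs => ?_) hδ0
      exact mul_pos (rpow_pos_of_pos (by linarith [hs.2]) _)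
        (hpos s ⟨hs.1.le, by linarith [hs.2]⟩)
    have h2 := hE.eq δ ⟨hδ0.le, hδb⟩
    simp only [zero_add, hE.apply_zero hb]
    nlinarith [mul_pos hK h1]
  · intro t ht
    have e1 := hE.eq t ⟨ht.1, by linarith [ht.2]⟩
    have e2 := hE.eq (t + δ) ⟨by linarith [ht.1], by linarith [ht.2]⟩
    have e3 : abelIntegral α E (t + δ) =
        (∫ s in (0 : ℝ)..δ, (t + δ - s) ^ (α - 1) * E s) +
          abelIntegral α (fun s => E (s + δ)) t := by
      have h := intervalIntegral.integral_comp_add_right (a := 0) (b := t)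
        (fun s => (t + δ - s) ^ (α - 1) * E s) δ
      simp only [add_sub_add_right_eq_sub, zero_add] at h
      rw [abelIntegral, abelIntegral, h]
      exact (intervalIntegral.integral_add_adjacent_intervals
        (intervalIntegrable_sub_rpow_mul hα0 hc _ _ _)
        (intervalIntegrable_sub_rpow_mul hα0 hc _ _ _)).symm
    rw [abelIntegral_sub hα0 hc hcδ, e1, e2, e3]
    ring
  · intro t t' ht htt' _
    simp only [mul_assoc, ← intervalIntegral.integral_mul_const]
    refine mul_le_mul_of_nonneg_left ?_ hK.le
    refine intervalIntegral.integral_mono_on hδ0.le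
      ?_ ?_ fun s hs => ?_
    · simpa only [mul_assoc] using
        (intervalIntegrable_sub_rpow_mul hα0 hc (t + δ) 0 δ).mul_const (t' ^ (α - 1))
    · simpa only [mul_assoc] using
        (intervalIntegrable_sub_rpow_mul hα0 hc (t' + δ) 0 δ).mul_const (t ^ (α - 1))
    · have hs1 : 0 ≤ δ - s := by linarith [hs.2]
      have h1 : (t + δ - s) ^ (α - 1) * t' ^ (α - 1) ≤ (t' + δ - s) ^ (α - 1) * t ^ (α - 1) := by
        rw [← mul_rpow (by linarith) (by linarith), ← mul_rpow (by linarith) ht.le]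
        refine rpow_le_rpow_of_nonpos (mul_pos (by linarith) ht) ?_ (by linarith)
        nlinarith
      have h2 := mul_le_mul_of_nonneg_right h1 (hpos s ⟨hs.1, by linarith [hs.2]⟩).le
      linarith

/-- Comparison with the fundamental solution. -/
theorem IsAbelRelaxation.mul_le {α K b T d : ℝ} {E w h : ℝ → ℝ} (hα0 : 0 < α) (hα1 : α < 1)
    (hK : 0 < K) (hE : IsAbelRelaxation α K b E) (hT : 0 < T) (hTb : T ≤ b)
    (hw : Continuous w) (hh : Continuous h)
    (heq : ∀ t ∈ Icc 0 T, w t = d + abelIntegral α h t)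
    (hq : ∀ t ∈ Icc 0 T, 0 ≤ h t + K * w t) :
    ∀ t ∈ Icc 0 T, d * E t ≤ w t := by
  have hb : 0 ≤ b := by linarith
  have hc := hE.continuous
  have hanti := hE.antitoneOn hα0 hα1 hK hb
  have hE0 := hE.apply_zero hb
  have hcq : Continuous fun s => h s + K * w s := by fun_prop
  have ident : ∀ t ∈ Icc 0 T, K * ∫ s in (0 : ℝ)..t, (w s - d * E s) =
      ∫ s in (0 : ℝ)..t, (1 - E (t - s)) * (h s + K * w s) := by
    intro t ht
    have i1 : ∫ s in (0 : ℝ)..t, E (t - s) * w s =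
        d * (∫ s in (0 : ℝ)..t, E s) + ∫ s in (0 : ℝ)..t, E (t - s) * abelIntegral α h s := by
      have hr := intervalIntegral.integral_comp_sub_left (a := 0) (b := t) E t
      simp only [sub_self, sub_zero] at hr
      rw [← hr, ← intervalIntegral.integral_const_mul, ← intervalIntegral.integral_add]
      · refine intervalIntegral.integral_congr fun s hs => ?_
        rw [uIcc_of_le ht.1] at hs
        simp only [heq s ⟨hs.1, hs.2.trans ht.2⟩]
        ring
      · exact Continuous.intervalIntegrable (by fun_prop) _ _
      · have := continuous_abelIntegral hα0 hh
        exact Continuous.intervalIntegrable (by fun_prop) _ _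
    have i2 : K * ∫ s in (0 : ℝ)..t, abelIntegral α E (t - s) * h s =
        ∫ s in (0 : ℝ)..t, (1 - E (t - s)) * h s := by
      rw [← intervalIntegral.integral_const_mul]
      refine intervalIntegral.integral_congr fun s hs => ?_
      rw [uIcc_of_le ht.1] at hs
      simp only [hE.eq (t - s) ⟨by linarith [hs.2], by linarith [hs.1, ht.2]⟩]
      ring
    have i3 : ∫ s in (0 : ℝ)..t, (1 - E (t - s)) * (h s + K * w s) =
        (∫ s in (0 : ℝ)..t, (1 - E (t - s)) * h s) + K * (∫ s in (0 : ℝ)..t, w s) -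
          K * ∫ s in (0 : ℝ)..t, E (t - s) * w s := by
      rw [← intervalIntegral.integral_const_mul, ← intervalIntegral.integral_const_mul,
        ← intervalIntegral.integral_add, ← intervalIntegral.integral_sub]
      · congr 1; ext s; ring
      all_goals exact Continuous.intervalIntegrable (by fun_prop) _ _
    have i4 : ∫ s in (0 : ℝ)..t, (w s - d * E s) =
        (∫ s in (0 : ℝ)..t, w s) - d * ∫ s in (0 : ℝ)..t, E s := by
      rw [← intervalIntegral.integral_const_mul, ← intervalIntegral.integral_sub]
      all_goals exact Continuous.intervalIntegrable (by fun_prop) _ _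
    rw [integral_mul_abelIntegral hα0 hc hh ht.1] at i1
    rw [i3, ← i2, i4, i1]
    ring
  have hcv : Continuous fun s => w s - d * E s := by fun_prop
  have hmono : MonotoneOn (fun t => ∫ s in (0 : ℝ)..t, (w s - d * E s)) (Icc 0 T) := by
    intro t₁ h₁ t₂ h₂ h₁₂
    refine le_of_mul_le_mul_left ?_ hK
    simp only
    rw [ident t₁ h₁, ident t₂ h₂, ← intervalIntegral.integral_add_adjacent_intervals
      (a := 0) (b := t₁) (c := t₂) (Continuous.intervalIntegrable (by fun_prop) _ _)
      (Continuous.intervalIntegrable (by fun_prop) _ _)]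
    have j1 : ∫ s in (0 : ℝ)..t₁, (1 - E (t₁ - s)) * (h s + K * w s) ≤
        ∫ s in (0 : ℝ)..t₁, (1 - E (t₂ - s)) * (h s + K * w s) := by
      refine intervalIntegral.integral_mono_on h₁.1
        (Continuous.intervalIntegrable (by fun_prop) _ _)
        (Continuous.intervalIntegrable (by fun_prop) _ _) fun s hs => ?_
      refine mul_le_mul_of_nonneg_right ?_ (hq s ⟨hs.1, hs.2.trans h₁.2⟩)
      have := hanti (a := t₁ - s) (b := t₂ - s) ⟨by linarith [hs.2], by linarith [hs.1, h₁.2]⟩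
        ⟨by linarith [hs.2], by linarith [hs.1, h₂.2]⟩ (by linarith)
      linarith
    have j2 : 0 ≤ ∫ s in t₁..t₂, (1 - E (t₂ - s)) * (h s + K * w s) := by
      refine intervalIntegral.integral_nonneg h₁₂ fun s hs => ?_
      refine mul_nonneg ?_ (hq s ⟨h₁.1.trans hs.1, hs.2.trans h₂.2⟩)
      have := hanti (a := 0) (b := t₂ - s) ⟨le_rfl, hb⟩
        ⟨by linarith [hs.2], by linarith [hs.1, h₁.1, h₂.2]⟩ (by linarith [hs.2])
      linarith
    linarith
  intro t ht
  have hd := (hcv.integral_hasStrictDerivAt 0 t).hasDerivAt.hasDerivWithinAt (s := Icc 0 T)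
  have := hmono.derivWithin_nonneg (x := t)
  rw [hd.derivWithin (uniqueDiffOn_Icc hT t ht)] at this
  linarith

/-- `z` is a continuous solution of `z(t) = c + ∫₀ᵗ (t - s) ^ (α - 1) g(s, z(s)) ds` on `[0, b]`. -/
structure IsAbelSolution (α b : ℝ) (g : ℝ → ℝ → ℝ) (c : ℝ) (z : ℝ → ℝ) : Prop where
  continuous : Continuous z
  eq : ∀ t ∈ Icc 0 b, z t = c + abelIntegral α (fun s => g s (z s)) t

theorem exists_exponential_weight {α K : ℝ} (hα : 0 < α) (hK : 0 < K) :
    ∃ ν : ℝ, 0 < ν ∧ K * ((1 / ν) ^ α * Gamma α) = 1 / 2 := by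
  have hG := Gamma_pos_of_pos hα
  refine ⟨(2 * K * Gamma α) ^ (1 / α), by positivity, ?_⟩
  rw [div_rpow zero_le_one (by positivity), ← rpow_mul (by positivity), one_div_mul_cancel hα.ne',
    rpow_one, one_rpow]
  field_simp

section Solutions

variable {α K b : ℝ} {g : ℝ → ℝ → ℝ}

theorem exists_isAbelSolution (hα : 0 < α) (hK : 0 < K) (hb : 0 ≤ b)
    (hg : Continuous fun p : ℝ × ℝ => g p.1 p.2)
    (hL : ∀ t ∈ Icc 0 b, ∀ u v, |g t u - g t v| ≤ K * |u - v|) (c : ℝ) :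
    ∃ z, IsAbelSolution α b g c z := by
  obtain ⟨ν, hν, hKν⟩ := exists_exponential_weight hα hK
  let ext : C(Icc (0 : ℝ) b, ℝ) → ℝ → ℝ := fun x s => exp (ν * s) * x (projIcc 0 b hb s)
  have hext : ∀ x, Continuous (ext x) := fun x => by
    have := x.continuous.comp (continuous_projIcc (a := (0 : ℝ)) (b := b) (h := hb))
    exact (by fun_prop : Continuous fun s : ℝ => exp (ν * s)).mul this
  have hgx : ∀ x, Continuous fun s => g s (ext x s) := fun x =>
    hg.comp (continuous_id.prodMk (hext x))
  have hA : ∀ x, Continuous (abelIntegral α fun s => g s (ext x s)) := fun x =>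
    continuous_abelIntegral hα (hgx x)
  let F : C(Icc (0 : ℝ) b, ℝ) → C(Icc (0 : ℝ) b, ℝ) := fun x =>
    ⟨fun t => exp (-(ν * t)) * (c + abelIntegral α (fun s => g s (ext x s)) t), by
      have := hA x
      fun_prop⟩
  have hF : ContractingWith (1 / 2) F := by
    refine ⟨by rw [← NNReal.coe_lt_coe]; norm_num, LipschitzWith.of_dist_le_mul fun x y => ?_⟩
    rw [ContinuousMap.dist_le (by positivity)]
    intro t
    have key := abs_abelIntegral_sub_le (ν := ν) (C := K * dist x y) hα hν (by positivity) t.2.1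
      (hgx x) (hgx y) fun s hs => by
        refine (hL s ⟨hs.1, hs.2.trans t.2.2⟩ _ _).trans ?_
        rw [mul_assoc]
        refine mul_le_mul_of_nonneg_left ?_ hK.le
        rw [← mul_sub, abs_mul, abs_of_pos (exp_pos _), mul_comm]
        exact mul_le_mul_of_nonneg_right (x.dist_apply_le_dist _) (exp_pos _).le
    rw [Real.dist_eq]
    simp only [F, ContinuousMap.coe_mk]
    rw [← mul_sub, add_sub_add_left_eq_sub, abs_mul, abs_of_pos (exp_pos _)]
    calc _ ≤ exp (-(ν * t)) * (K * dist x y * ((1 / ν) ^ α * Gamma α) * exp (ν * t)) :=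
          mul_le_mul_of_nonneg_left key (exp_pos _).le
      _ = (K * ((1 / ν) ^ α * Gamma α)) * dist x y * (exp (-(ν * t)) * exp (ν * t)) := by ring
      _ = _ := by rw [hKν, ← Real.exp_add]; simp
  set x := ContractingWith.fixedPoint F hF
  have hx : F x = x := hF.fixedPoint_isFixedPt
  refine ⟨ext x, hext x, fun t ht => ?_⟩
  have h1 : x ⟨t, ht⟩ = exp (-(ν * t)) * (c + abelIntegral α (fun s => g s (ext x s)) t) := by
    conv_lhs => rw [← hx]
    rfl
  calc ext x t = exp (ν * t) * x ⟨t, ht⟩ := by simp only [ext, projIcc_of_mem hb ht]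
    _ = _ := by
      rw [h1, ← mul_assoc, ← Real.exp_add]
      simp

theorem exists_isAbelRelaxation (hα : 0 < α) (hK : 0 < K) (hb : 0 ≤ b) :
    ∃ E, IsAbelRelaxation α K b E := by
  obtain ⟨E, hE⟩ := exists_isAbelSolution (g := fun _ u => -K * u) hα hK hb (by fun_prop)
    (fun t _ u v => by rw [← mul_sub, abs_mul, abs_neg, abs_of_pos hK]) 1
  refine ⟨E, hE.continuous, fun t ht => ?_⟩
  rw [hE.eq t ht, abelIntegral_const_mul]
  ring

/-- Solutions depend Lipschitz continuously on their initial values. -/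
theorem IsAbelSolution.exists_dist_le (hα : 0 < α) (hK : 0 < K) (hb : 0 ≤ b)
    (hg : Continuous fun p : ℝ × ℝ => g p.1 p.2)
    (hL : ∀ t ∈ Icc 0 b, ∀ u v, |g t u - g t v| ≤ K * |u - v|) :
    ∃ C : ℝ, 0 ≤ C ∧ ∀ {c₁ c₂ : ℝ} {z₁ z₂ : ℝ → ℝ}, IsAbelSolution α b g c₁ z₁ →
      IsAbelSolution α b g c₂ z₂ → |z₁ b - z₂ b| ≤ C * |c₁ - c₂| := by
  obtain ⟨ν, hν, hKν⟩ := exists_exponential_weight hα hK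
  refine ⟨2 * exp (ν * b), by positivity, fun {c₁ c₂ z₁ z₂} h₁ h₂ => ?_⟩
  have e1 := h₁.continuous
  have e2 := h₂.continuous
  obtain ⟨τ, hτ, hmax⟩ := isCompact_Icc.exists_isMaxOn (nonempty_Icc.2 hb)
    (by fun_prop : Continuous fun t => exp (-(ν * t)) * |z₁ t - z₂ t|).continuousOn
  set M := exp (-(ν * τ)) * |z₁ τ - z₂ τ| with hM
  have hM0 : 0 ≤ M := by positivity
  have hle : ∀ s ∈ Icc 0 b, |z₁ s - z₂ s| ≤ M * exp (ν * s) := by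
    intro s hs
    have h : exp (-(ν * s)) * |z₁ s - z₂ s| ≤ M := hmax hs
    rwa [Real.exp_neg, inv_mul_le_iff₀ (exp_pos _), mul_comm] at h
  have key := abs_abelIntegral_sub_le (ν := ν) (C := K * M) (t := τ) hα hν (by positivity) hτ.1
    (hg.comp (continuous_id.prodMk e1)) (hg.comp (continuous_id.prodMk e2)) fun s hs => by
      have hs' : s ∈ Icc 0 b := ⟨hs.1, hs.2.trans hτ.2⟩
      refine (hL s hs' _ _).trans ?_
      rw [mul_assoc]
      exact mul_le_mul_of_nonneg_left (hle s hs') hK.le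
  have h3 : |z₁ τ - z₂ τ| ≤ |c₁ - c₂| + 1 / 2 * M * exp (ν * τ) := by
    rw [h₁.eq τ hτ, h₂.eq τ hτ, add_sub_add_comm]
    refine (abs_add_le _ _).trans (add_le_add le_rfl (key.trans_eq ?_))
    rw [← hKν]; ring
  have h4 : M ≤ |c₁ - c₂| + 1 / 2 * M := by
    have h5 : M * exp (ν * τ) = |z₁ τ - z₂ τ| := by
      rw [hM, mul_right_comm, ← Real.exp_add]; simp
    have h6 : 1 ≤ exp (ν * τ) := Real.one_le_exp (mul_nonneg hν.le hτ.1)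
    have h7 := mul_le_mul_of_nonneg_left h6 (abs_nonneg (c₁ - c₂))
    refine le_of_mul_le_mul_right ?_ (exp_pos (ν * τ))
    nlinarith
  calc |z₁ b - z₂ b| ≤ M * exp (ν * b) := hle b ⟨hb, le_rfl⟩
    _ ≤ (2 * |c₁ - c₂|) * exp (ν * b) :=
      mul_le_mul_of_nonneg_right (by linarith) (exp_pos _).le
    _ = _ := by ring

variable {c₁ c₂ : ℝ} {z₁ z₂ : ℝ → ℝ}

/-- Solutions with ordered initial values separate at least like the fundamental solution. -/
theorem IsAbelSolution.mul_le_sub (hα0 : 0 < α) (hα1 : α < 1) (hK : 0 < K) (hb : 0 ≤ b)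
    (hg : Continuous fun p : ℝ × ℝ => g p.1 p.2)
    (hL : ∀ t ∈ Icc 0 b, ∀ u v, |g t u - g t v| ≤ K * |u - v|) {E : ℝ → ℝ}
    (hE : IsAbelRelaxation α K b E) (h₁ : IsAbelSolution α b g c₁ z₁)
    (h₂ : IsAbelSolution α b g c₂ z₂) (hc : c₁ < c₂) :
    (c₂ - c₁) * E b ≤ z₂ b - z₁ b := by
  have e1 := h₁.continuous
  have e2 := h₂.continuous
  have g1 : Continuous fun s => g s (z₁ s) := hg.comp (continuous_id.prodMk e1)
  have g2 : Continuous fun s => g s (z₂ s) := hg.comp (continuous_id.prodMk e2)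
  have hw : Continuous fun t => z₂ t - z₁ t := by fun_prop
  have heq : ∀ t ∈ Icc 0 b, z₂ t - z₁ t =
      (c₂ - c₁) + abelIntegral α (fun s => g s (z₂ s) - g s (z₁ s)) t := by
    intro t ht
    rw [abelIntegral_sub hα0 g2 g1, h₁.eq t ht, h₂.eq t ht]
    ring
  have hw0 : z₂ 0 - z₁ 0 = c₂ - c₁ := by simpa using heq 0 ⟨le_rfl, hb⟩
  have comparison : ∀ T, 0 < T → T ≤ b → (∀ t ∈ Icc 0 T, 0 ≤ z₂ t - z₁ t) →
      ∀ t ∈ Icc 0 T, (c₂ - c₁) * E t ≤ z₂ t - z₁ t := by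
    intro T hT hTb hnonneg
    refine hE.mul_le hα0 hα1 hK hT hTb hw (g2.sub g1)
      (fun t ht => heq t ⟨ht.1, ht.2.trans hTb⟩) fun t ht => ?_
    have h := hL t ⟨ht.1, ht.2.trans hTb⟩ (z₂ t) (z₁ t)
    rw [abs_of_nonneg (hnonneg t ht)] at h
    change 0 ≤ g t (z₂ t) - g t (z₁ t) + K * (z₂ t - z₁ t)
    linarith [neg_abs_le (g t (z₂ t) - g t (z₁ t))]
  have hEpos := hE.pos hα0 hα1 hK.le hb
  have hpos : ∀ t ∈ Icc 0 b, 0 < z₂ t - z₁ t := by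
    by_contra! hneg
    have hcpt : IsCompact {t ∈ Icc 0 b | z₂ t - z₁ t ≤ 0} :=
      isCompact_Icc.inter_right (isClosed_le hw continuous_const)
    obtain ⟨T, ⟨⟨hT0, hTb⟩, hwT⟩, hmin⟩ := hcpt.exists_isLeast hneg
    have hTpos : 0 < T := lt_of_le_of_ne hT0 fun h => by rw [← h, hw0] at hwT; linarith
    obtain ⟨s, hs, hs0⟩ := intermediate_value_Icc' hT0 hw.continuousOn
      (show (0 : ℝ) ∈ Icc (z₂ T - z₁ T) (z₂ 0 - z₁ 0) from ⟨hwT, by linarith⟩)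
    have hsT : s = T := le_antisymm hs.2 (hmin ⟨⟨hs.1, hs.2.trans hTb⟩, hs0.le⟩)
    rw [hsT] at hs0
    have hnonneg : ∀ t ∈ Icc 0 T, 0 ≤ z₂ t - z₁ t := by
      intro t ht
      by_contra! h
      have : t = T := le_antisymm ht.2 (hmin ⟨⟨ht.1, ht.2.trans hTb⟩, h.le⟩)
      rw [this] at h
      exact h.ne hs0
    have h1 := comparison T hTpos hTb hnonneg T ⟨hT0, le_rfl⟩
    have h2 := mul_pos (sub_pos.2 hc) (hEpos T ⟨hT0, hTb⟩)
    linarith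
  rcases hb.eq_or_lt with rfl | hb'
  · rw [hw0, hE.apply_zero le_rfl, mul_one]
  · exact comparison b hb' le_rfl (fun t ht => (hpos t ht).le) b ⟨hb, le_rfl⟩

theorem existsUnique_initial_value_isAbelSolution (hα0 : 0 < α) (hα1 : α < 1) (hK : 0 < K)
    (hb : 0 ≤ b) (hg : Continuous fun p : ℝ × ℝ => g p.1 p.2)
    (hL : ∀ t ∈ Icc 0 b, ∀ u v, |g t u - g t v| ≤ K * |u - v|) (c : ℝ) :
    ∃! c₀, ∃ z, IsAbelSolution α b g c₀ z ∧ z b = c := by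
  obtain ⟨E, hE⟩ := exists_isAbelRelaxation (b := b) hα0 hK hb
  have hEb : 0 < E b := hE.pos hα0 hα1 hK.le hb b ⟨hb, le_rfl⟩
  choose z hz using exists_isAbelSolution hα0 hK hb hg hL
  obtain ⟨C, hC0, hC⟩ := IsAbelSolution.exists_dist_le hα0 hK hb hg hL
  have hcont : Continuous fun d => z d b := by
    refine (LipschitzWith.of_dist_le_mul (K := ⟨C, hC0⟩) fun d₁ d₂ => ?_).continuous
    exact hC (hz d₁) (hz d₂)
  have hsep : ∀ d₁ d₂, d₁ < d₂ → (d₂ - d₁) * E b ≤ z d₂ b - z d₁ b := fun d₁ d₂ hd =>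
    (hz d₁).mul_le_sub hα0 hα1 hK hb hg hL hE (hz d₂) hd
  have htop : Filter.Tendsto (fun d => z d b) Filter.atTop Filter.atTop := by
    refine Filter.tendsto_atTop_mono' _ (f₁ := fun d => z 0 b + d * E b) ?_
      (Filter.tendsto_atTop_add_const_left _ _ (Filter.tendsto_id.atTop_mul_const hEb))
    filter_upwards [Filter.eventually_gt_atTop 0] with d hd
    linarith [hsep 0 d hd]
  have hbot : Filter.Tendsto (fun d => z d b) Filter.atBot Filter.atBot := by
    refine Filter.tendsto_atBot_mono' _ (f₁ := fun d => z 0 b + d * E b) ?_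
      (Filter.tendsto_atBot_add_const_left _ _ (Filter.tendsto_id.atBot_mul_const hEb))
    filter_upwards [Filter.eventually_lt_atBot 0] with d hd
    linarith [hsep d 0 hd]
  obtain ⟨c₀, hc₀⟩ := hcont.surjective htop hbot c
  refine ⟨c₀, ⟨z c₀, hz c₀, hc₀⟩, ?_⟩
  rintro d ⟨y, hy, hyb⟩
  have hc₀' : z c₀ b = c := hc₀
  rcases lt_trichotomy d c₀ with h | h | h
  · have := hy.mul_le_sub hα0 hα1 hK hb hg hL hE (hz c₀) h
    nlinarith [mul_pos (sub_pos.2 h) hEb]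
  · exact h
  · have := (hz c₀).mul_le_sub hα0 hα1 hK hb hg hL hE hy h
    nlinarith [mul_pos (sub_pos.2 h) hEb]

end Solutions

/-- Multiplication by `exp (lam * t)` removes the tempering from the Volterra integral. -/
theorem tempered_integral_eq_abelIntegral (α lam : ℝ) (h : ℝ → ℝ) (t : ℝ) :
    (1 / Gamma α) * ∫ s in (0 : ℝ)..t, exp (-lam * (t - s)) * (t - s) ^ (α - 1) * h s =
      exp (-lam * t) * abelIntegral α (fun s => 1 / Gamma α * (exp (lam * s) * h s)) t := by
  rw [abelIntegral_const_mul, abelIntegral, mul_left_comm,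
    ← intervalIntegral.integral_const_mul (exp (-lam * t))]
  congr 2; ext s
  rw [show -lam * (t - s) = -lam * t + lam * s by ring, Real.exp_add]
  ring

/-- shooting correspondence — for each terminal value c there is exactly one
initial value c₀ whose solution of the tempered Volterra equation hits c e^{-λb} at t = b. -/
theorem tempered_shooting_unique_initial_value
    (α lam b L : ℝ) (hα0 : 0 < α) (hα1 : α < 1) (hlam : 0 ≤ lam) (hb : 0 < b)
    (f : ℝ → ℝ → ℝ) (hf : Continuous fun p : ℝ × ℝ => f p.1 p.2)
    (hL : ∀ t ∈ Set.Icc (0 : ℝ) b, ∀ u v : ℝ, |f t u - f t v| ≤ L * |u - v|) :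
    ∀ c : ℝ, ∃! c₀ : ℝ, ∃ y : ℝ → ℝ,
      ContinuousOn y (Set.Icc 0 b) ∧
      (∀ t ∈ Set.Icc (0 : ℝ) b,
        y t = c₀ * Real.exp (-lam * t) +
          (1 / Real.Gamma α) *
            ∫ s in (0 : ℝ)..t, Real.exp (-lam * (t - s)) * (t - s) ^ (α - 1) * f s (y s)) ∧
      y b = c * Real.exp (-lam * b) := by
  intro c
  have hG := Gamma_pos_of_pos hα0
  have hee : ∀ t, exp (lam * t) * exp (-lam * t) = 1 := fun t => by
    rw [← Real.exp_add]; simp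
  set g : ℝ → ℝ → ℝ := fun s u =>
    1 / Gamma α * (exp (lam * s) * f s (exp (-lam * s) * u)) with hgdef
  have hg : Continuous fun p : ℝ × ℝ => g p.1 p.2 := by
    have : Continuous fun p : ℝ × ℝ => f p.1 (exp (-lam * p.1) * p.2) :=
      hf.comp (f := fun p : ℝ × ℝ => (p.1, exp (-lam * p.1) * p.2)) (by fun_prop)
    fun_prop
  have hgL : ∀ t ∈ Icc 0 b, ∀ u v, |g t u - g t v| ≤ (|L| + 1) / Gamma α * |u - v| := by
    intro t ht u v
    have h1 := hL t ht (exp (-lam * t) * u) (exp (-lam * t) * v)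
    rw [← mul_sub (exp (-lam * t)), abs_mul, abs_of_pos (exp_pos _)] at h1
    have h2 := mul_le_mul_of_nonneg_left h1 (exp_pos (lam * t)).le
    have h3 : exp (lam * t) * (L * (exp (-lam * t) * |u - v|)) = L * |u - v| := by
      linear_combination L * |u - v| * hee t
    rw [h3] at h2
    simp only [hgdef]
    rw [← mul_sub, ← mul_sub, abs_mul, abs_mul, abs_of_pos (exp_pos _),
      abs_of_pos (by positivity : 0 < 1 / Gamma α), div_mul_eq_mul_div, one_mul,
      div_mul_eq_mul_div]
    refine div_le_div_of_nonneg_right (h2.trans ?_) hG.le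
    exact mul_le_mul_of_nonneg_right (by linarith [le_abs_self L]) (abs_nonneg _)
  have core := existsUnique_initial_value_isAbelSolution hα0 hα1
    (by positivity : 0 < (|L| + 1) / Gamma α) hb.le hg hgL c
  refine (existsUnique_congr fun c₀ => ?_).1 core
  constructor
  · rintro ⟨z, hz, hzb⟩
    have hzc := hz.continuous
    refine ⟨fun t => exp (-lam * t) * z t, by fun_prop, fun t ht => ?_, by
      simp only [hzb, mul_comm]⟩
    simp only
    rw [tempered_integral_eq_abelIntegral α lam (fun s => f s (exp (-lam * s) * z s)),
      hz.eq t ht]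
    ring
  · rintro ⟨y, hy, hyeq, hyb⟩
    have hagree : ∀ t ∈ Icc 0 b, IccExtend hb.le ((Icc 0 b).domRestrict y) t = y t := by
      intro t ht
      rw [IccExtend_of_mem _ _ ht]
      rfl
    have hcont : Continuous (IccExtend hb.le ((Icc 0 b).domRestrict y)) :=
      hy.domRestrict.Icc_extend'
    refine ⟨fun t => exp (lam * t) * IccExtend hb.le ((Icc 0 b).domRestrict y) t,
      ⟨by fun_prop, fun t ht => ?_⟩, ?_⟩
    · have h1 : abelIntegral α (fun s => g s (exp (lam * s) *
          IccExtend hb.le ((Icc 0 b).domRestrict y) s)) t =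
          abelIntegral α (fun s => 1 / Gamma α * (exp (lam * s) * f s (y s))) t := by
        refine abelIntegral_congr ht.1 fun s hs => ?_
        rw [hagree s ⟨hs.1, hs.2.trans ht.2⟩]
        simp only [hgdef]
        rw [← mul_assoc (exp (-lam * s)), mul_comm (exp (-lam * s)), hee, one_mul]
      rw [h1, hagree t ht, hyeq t ht, tempered_integral_eq_abelIntegral α lam (fun s => f s (y s))]
      linear_combination (c₀ +
        abelIntegral α (fun s => 1 / Gamma α * (exp (lam * s) * f s (y s))) t) * hee t
    · simp only
      rw [hagree b ⟨hb.le, le_rfl⟩, hyb]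
      linear_combination c * hee b
end
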